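/- arXiv:2404.17705 — 3 statements merged into one kernel-verified Lean document; each statement's English description precedes it below -/
import Mathlib

section
/- Let r ∈ ℕ with r ≥ 2 and p ∈ (0,1), and let N be negative binomial with parameters r and p. Then the variance of the unbiased estimator λ̂ = −H_{N−1} + H_{r−1} of log p, namely Var[λ̂] = Σ_{n≥r} C(n−1, r−1) p^r (1−p)^{n−r} (H_{r−1} − H_{n−1} − log p)², satisfies Var[λ̂] < (1/(r−1+p)) · ( (1 + p/(2r−1) − 1/(4r(2r−1))) (1−p) + p/(4(r−1)) ). -/
open scoped BigOperators

/-- Expectation of `f(N)` where `N` is negative binomial with parameters `s` and `q`: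
`E[f(N)] = Σ_{n ≥ s} f(n) C(n−1, s−1) q^s (1−q)^{n−s}`, written with `n = s + k`. -/
noncomputable def negbinExp (s : ℕ) (q : ℝ) (f : ℕ → ℝ) : ℝ :=
  ∑' k : ℕ, ((s + k - 1).choose (s - 1) : ℝ) * q ^ s * (1 - q) ^ k * f (s + k)

/-- Expectation of `f(N₁, N₂)` for independent negative binomials with parameters
`(s₁, q₁)` and `(s₂, q₂)`. -/
noncomputable def negbinExp2 (s₁ : ℕ) (q₁ : ℝ) (s₂ : ℕ) (q₂ : ℝ) (f : ℕ → ℕ → ℝ) : ℝ :=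
  ∑' k₁ : ℕ, ∑' k₂ : ℕ,
    ((s₁ + k₁ - 1).choose (s₁ - 1) : ℝ) * q₁ ^ s₁ * (1 - q₁) ^ k₁ *
      (((s₂ + k₂ - 1).choose (s₂ - 1) : ℝ) * q₂ ^ s₂ * (1 - q₂) ^ k₂) *
      f (s₁ + k₁) (s₂ + k₂)

/-- The m-th harmonic number `H_m = Σ_{k=1}^m 1/k`, `H_0 = 0`. -/
noncomputable def H (m : ℕ) : ℝ := ∑ k ∈ Finset.range m, (1 : ℝ) / (k + 1)

/-- A real sequence bounded in absolute value by a polynomial. -/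
def PolyGrowth (b : ℕ → ℝ) : Prop :=
  ∃ (C : ℝ) (m : ℕ), ∀ k : ℕ, |b k| ≤ C * ((k : ℝ) + 1) ^ m

namespace PolyGrowth

theorem mul {a b : ℕ → ℝ} (ha : PolyGrowth a) (hb : PolyGrowth b) :
    PolyGrowth (fun k => a k * b k) := by
  obtain ⟨C, m, hC⟩ := ha
  obtain ⟨D, n, hD⟩ := hb
  refine ⟨C * D, m + n, fun k => ?_⟩
  rw [abs_mul, pow_add]
  calc |a k| * |b k| ≤ (C * ((k : ℝ) + 1) ^ m) * (D * ((k : ℝ) + 1) ^ n) :=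
        mul_le_mul (hC k) (hD k) (abs_nonneg _) ((abs_nonneg _).trans (hC k))
    _ = _ := by ring

theorem shift {a : ℕ → ℝ} (ha : PolyGrowth a) : PolyGrowth (fun k => a (k + 1)) := by
  obtain ⟨C, m, hC⟩ := ha
  have hC0 : 0 ≤ C := by simpa using (abs_nonneg _).trans (hC 0)
  refine ⟨C * 2 ^ m, m, fun k => (hC (k + 1)).trans ?_⟩
  rw [mul_assoc, ← mul_pow]
  gcongr
  push_cast
  have : (0 : ℝ) ≤ k := k.cast_nonneg
  linarith

theorem natCast_add_one : PolyGrowth (fun k => (k : ℝ) + 1) :=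
  ⟨1, 1, fun k => by rw [abs_of_nonneg (by positivity)]; simp⟩

theorem of_abs_le {a : ℕ → ℝ} (h : ∀ k : ℕ, |a k| ≤ (k : ℝ) + 1) : PolyGrowth a :=
  ⟨1, 1, fun k => by simpa using h k⟩

theorem choose (s : ℕ) : PolyGrowth (fun k => ((s + k).choose s : ℝ)) := by
  refine ⟨((s : ℝ) + 1) ^ s, s, fun k => ?_⟩
  rw [Nat.abs_cast, ← mul_pow]
  calc ((s + k).choose s : ℝ) ≤ ((s : ℝ) + k) ^ s := by exact_mod_cast Nat.choose_le_pow _ _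
    _ ≤ _ := by
      gcongr
      have h1 : (0 : ℝ) ≤ k := k.cast_nonneg
      have h2 : (0 : ℝ) ≤ s := s.cast_nonneg
      nlinarith

theorem summable_mul_pow {b : ℕ → ℝ} (hb : PolyGrowth b) {x : ℝ} (hx : |x| < 1) :
    Summable (fun k => b k * x ^ k) := by
  obtain ⟨C, m, hC⟩ := hb
  obtain ⟨ρ, hxρ, hρ⟩ := exists_between hx
  have hρ0 : 0 < ρ := (abs_nonneg x).trans_lt hxρ
  have h := (summable_nat_add_iff 1).2
    (summable_pow_mul_geometric_of_norm_lt_one m (r := ρ) (by rwa [Real.norm_of_nonneg hρ0.le]))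
  refine Summable.of_norm_bounded (h.mul_left (C / ρ)) fun k => ?_
  rw [Real.norm_eq_abs, abs_mul, abs_pow]
  calc |b k| * |x| ^ k ≤ (C * ((k : ℝ) + 1) ^ m) * ρ ^ k :=
        mul_le_mul (hC k) (by gcongr) (by positivity) ((abs_nonneg _).trans (hC k))
    _ = _ := by push_cast; field_simp; ring

theorem hasDerivAt_tsum {b : ℕ → ℝ} (hb : PolyGrowth b) {x : ℝ} (hx : |x| < 1) :
    HasDerivAt (fun y => ∑' k, b k * y ^ k) (∑' k : ℕ, ((k : ℝ) + 1) * b (k + 1) * x ^ k) x := by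
  obtain ⟨ρ, hxρ, hρ⟩ := exists_between hx
  have hρ0 : 0 < ρ := (abs_nonneg x).trans_lt hxρ
  have hs : Summable (fun k : ℕ => ((k : ℝ) + 1) * b (k + 1) * ρ ^ k) :=
    (natCast_add_one.mul hb.shift).summable_mul_pow (by rwa [abs_of_pos hρ0])
  have hu : Summable (fun k : ℕ => |b k * (k * ρ ^ (k - 1))|) := by
    rw [← summable_nat_add_iff 1]
    refine hs.abs.congr fun k => ?_
    rw [Nat.add_sub_cancel]
    push_cast
    congr 1
    ring
  have hbound : ∀ (k : ℕ) (y : ℝ), y ∈ Set.Ioo (-ρ) ρ →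
      ‖b k * (k * y ^ (k - 1))‖ ≤ |b k * (k * ρ ^ (k - 1))| := by
    intro k y hy
    have hyρ : |y| ≤ |ρ| := by rw [abs_of_pos hρ0]; exact (abs_lt.2 hy).le
    rw [Real.norm_eq_abs]
    simp only [abs_mul, abs_pow]
    gcongr
  have hxm : x ∈ Set.Ioo (-ρ) ρ := abs_lt.1 hxρ
  have hD := hasDerivAt_tsum_of_isPreconnected (g := fun k y => b k * y ^ k)
    (g' := fun k y => b k * (k * y ^ (k - 1))) hu isOpen_Ioo isPreconnected_Ioo
    (fun k y _ => (hasDerivAt_pow k y).const_mul (b k)) hbound hxm (hb.summable_mul_pow hx) hxm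
  refine hD.congr_deriv ?_
  rw [(Summable.of_norm_bounded hu fun k => hbound k x hxm).tsum_eq_zero_add]
  simp only [Nat.cast_zero, zero_mul, mul_zero, zero_add, Nat.cast_add, Nat.cast_one,
    Nat.add_sub_cancel]
  exact tsum_congr fun k => by ring

end PolyGrowth

theorem add_one_mul_choose_succ (s k : ℕ) :
    ((k : ℝ) + 1) * ((s + (k + 1)).choose s : ℝ) = (s + k + 1) * ((s + k).choose s : ℝ) := by
  have h := Nat.choose_mul_succ_eq (s + k) s
  have e : s + k + 1 - s = k + 1 := by omega
  rw [e] at h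
  have h' : ((s + k).choose s : ℝ) * (s + k + 1) = ((s + (k + 1)).choose s : ℝ) * (k + 1) := by
    exact_mod_cast h
  linarith

/-- The expectation of `a (N - s - 1)` for `N` negative binomial with parameters `s + 1` and
`1 - x`. -/
noncomputable def negbinMean (s : ℕ) (a : ℕ → ℝ) (x : ℝ) : ℝ :=
  (1 - x) ^ (s + 1) * ∑' k : ℕ, ((s + k).choose s : ℝ) * a k * x ^ k

theorem PolyGrowth.summable_negbin {a : ℕ → ℝ} (ha : PolyGrowth a) (s : ℕ) {x : ℝ}
    (hx : |x| < 1) : Summable (fun k => ((s + k).choose s : ℝ) * a k * x ^ k) :=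
  ((PolyGrowth.choose s).mul ha).summable_mul_pow hx

theorem negbinMean_add {a b : ℕ → ℝ} (ha : PolyGrowth a) (hb : PolyGrowth b) (s : ℕ) {x : ℝ}
    (hx : |x| < 1) :
    negbinMean s (fun k => a k + b k) x = negbinMean s a x + negbinMean s b x := by
  unfold negbinMean
  rw [← mul_add, ← (ha.summable_negbin s hx).tsum_add (hb.summable_negbin s hx)]
  congr 1
  exact tsum_congr fun k => by ring

theorem negbinMean_const_mul (s : ℕ) (c : ℝ) (a : ℕ → ℝ) (x : ℝ) :
    negbinMean s (fun k => c * a k) x = c * negbinMean s a x := by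
  unfold negbinMean
  rw [mul_left_comm, ← tsum_mul_left (a := c)]
  congr 1
  exact tsum_congr fun k => by ring

theorem negbinMean_mono {a b : ℕ → ℝ} (ha : PolyGrowth a) (hb : PolyGrowth b)
    (hab : ∀ k, a k ≤ b k) (s : ℕ) {x : ℝ} (hx0 : 0 ≤ x) (hx1 : x < 1) :
    negbinMean s a x ≤ negbinMean s b x := by
  have hx : |x| < 1 := by rwa [abs_of_nonneg hx0]
  have h1 : 0 ≤ 1 - x := by linarith
  unfold negbinMean
  refine mul_le_mul_of_nonneg_left ?_ (by positivity)
  refine (ha.summable_negbin s hx).tsum_le_tsum (fun k => ?_) (hb.summable_negbin s hx)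
  gcongr
  exact hab k

theorem negbinMean_one (s : ℕ) {x : ℝ} (hx : |x| < 1) : negbinMean s (fun _ => 1) x = 1 := by
  have h := tsum_choose_mul_geometric_of_norm_lt_one s (r := x) hx
  have h1 : 1 - x ≠ 0 := by linarith [(abs_lt.1 hx).2]
  unfold negbinMean
  simp only [mul_one, Nat.add_comm s _]
  rw [h, Nat.add_comm 1 s]
  field_simp

theorem negbinMean_inv_pred (s : ℕ) (hs : 1 ≤ s) {x : ℝ} (hx : |x| < 1) :
    negbinMean s (fun k => 1 / ((s : ℝ) + k)) x = (1 - x) / s := by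
  obtain ⟨t, rfl⟩ : ∃ t, s = t + 1 := ⟨s - 1, by omega⟩
  have h := negbinMean_one t hx
  unfold negbinMean at h ⊢
  rw [pow_succ, mul_comm (_ ^ _) (1 - x), mul_assoc, div_eq_mul_inv]
  congr 1
  rw [← one_div, eq_div_iff (by positivity), mul_assoc]
  refine Eq.trans ?_ h
  congr 1
  rw [← tsum_mul_right]
  refine tsum_congr fun k => ?_
  have hc : ((t : ℝ) + k + 1) * ((t + k).choose t : ℝ)
      = ((t + 1 + k).choose (t + 1) : ℝ) * (t + 1) := by
    have := Nat.add_one_mul_choose_eq (t + k) t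
    rw [show t + k + 1 = t + 1 + k by ring] at this
    have h' := congrArg (Nat.cast (R := ℝ)) this
    push_cast at h'
    linarith
  have h0 : (t : ℝ) + 1 + k ≠ 0 := by positivity
  push_cast
  field_simp
  linear_combination (-x ^ k) * hc

theorem hasDerivAt_negbinMean {a : ℕ → ℝ} (ha : PolyGrowth a) (s : ℕ) {x : ℝ} (hx : |x| < 1) :
    HasDerivAt (negbinMean s a)
      (negbinMean s (fun k => ((s : ℝ) + 1 + k) * (a (k + 1) - a k)) x / (1 - x)) x := by
  have hb := (PolyGrowth.choose s).mul ha
  have h1 : 1 - x ≠ 0 := by linarith [(abs_lt.1 hx).2]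
  have hS := hb.hasDerivAt_tsum hx
  have hP : HasDerivAt (fun y : ℝ => (1 - y) ^ (s + 1)) (-(((s : ℝ) + 1) * (1 - x) ^ s)) x := by
    refine (((hasDerivAt_id' x).const_sub 1).fun_pow (s + 1)).congr_deriv ?_
    push_cast
    simp
  have hD := hP.mul hS
  refine hD.congr_deriv ?_
  have hsD : Summable (fun k : ℕ =>
      ((k : ℝ) + 1) * (((s + (k + 1)).choose s : ℝ) * a (k + 1)) * x ^ k) :=
    (PolyGrowth.natCast_add_one.mul hb.shift).summable_mul_pow hx
  have hsA : Summable (fun k : ℕ => ((s + k).choose s : ℝ) * a k * x ^ k) :=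
    hb.summable_mul_pow hx
  have hsE : Summable (fun k : ℕ =>
      (k : ℝ) * (((s + k).choose s : ℝ) * a k) * x ^ k) := by
    rw [← summable_nat_add_iff 1]
    refine (hsD.mul_right x).congr fun k => ?_
    push_cast
    ring
  have hE : ∑' k : ℕ, (k : ℝ) * (((s + k).choose s : ℝ) * a k) * x ^ k
      = x * ∑' k : ℕ, ((k : ℝ) + 1) * (((s + (k + 1)).choose s : ℝ) * a (k + 1)) * x ^ k := by
    rw [hsE.tsum_eq_zero_add, ← tsum_mul_left]
    simp only [Nat.cast_zero, zero_mul, zero_add]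
    refine tsum_congr fun k => ?_
    push_cast
    ring
  have hkey : ∑' k : ℕ, ((s + k).choose s : ℝ) * (((s : ℝ) + 1 + k) * (a (k + 1) - a k)) * x ^ k
      = (∑' k : ℕ, ((k : ℝ) + 1) * (((s + (k + 1)).choose s : ℝ) * a (k + 1)) * x ^ k)
        - (((s : ℝ) + 1) * ∑' k : ℕ, ((s + k).choose s : ℝ) * a k * x ^ k)
        - ∑' k : ℕ, (k : ℝ) * (((s + k).choose s : ℝ) * a k) * x ^ k := by
    rw [← tsum_mul_left, ← hsD.tsum_sub (hsA.mul_left _),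
      ← (hsD.sub (hsA.mul_left _)).tsum_sub hsE]
    refine tsum_congr fun k => ?_
    linear_combination (-(a (k + 1)) * x ^ k) * add_one_mul_choose_succ s k
  unfold negbinMean
  rw [hkey, hE, eq_div_iff h1]
  ring

theorem H_succ (m : ℕ) : H (m + 1) = H m + 1 / ((m : ℝ) + 1) :=
  Finset.sum_range_succ _ _

theorem H_add_sub_bounds (s k : ℕ) : 0 ≤ H (s + k) - H s ∧ H (s + k) - H s ≤ k := by
  induction k with
  | zero => simp
  | succ k ih =>
    have h0 : (0 : ℝ) ≤ 1 / (((s + k : ℕ) : ℝ) + 1) := by positivity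
    have h1 : 1 / (((s + k : ℕ) : ℝ) + 1) ≤ 1 := by
      rw [div_le_one (by positivity)]
      have : (0 : ℝ) ≤ ((s + k : ℕ) : ℝ) := Nat.cast_nonneg _
      linarith
    rw [← add_assoc, H_succ]
    push_cast at *
    constructor <;> linarith [ih.1, ih.2]

theorem polyGrowth_H_sub (s : ℕ) : PolyGrowth (fun k => H (s + k) - H s) :=
  .of_abs_le fun k => by
    rw [abs_of_nonneg (H_add_sub_bounds s k).1]
    linarith [(H_add_sub_bounds s k).2]

theorem polyGrowth_inv (s : ℕ) : PolyGrowth (fun k => 1 / ((s : ℝ) + k)) :=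
  .of_abs_le fun k => by
    have hk : (0 : ℝ) ≤ k := k.cast_nonneg
    rw [abs_of_nonneg (by positivity)]
    rcases Nat.eq_zero_or_pos (s + k) with h | h
    · have : (s : ℝ) + k = 0 := by exact_mod_cast h
      rw [this]
      simp
      positivity
    · have h' : (1 : ℝ) ≤ (s : ℝ) + k := by exact_mod_cast h
      exact ((div_le_one (by linarith)).2 h').trans (by linarith)

theorem polyGrowth_const (c : ℝ) : PolyGrowth (fun _ => c) := ⟨|c|, 0, fun _ => by simp⟩

theorem polyGrowth_inv_succ (s : ℕ) : PolyGrowth (fun k => 1 / ((s : ℝ) + 1 + k)) := by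
  simpa using polyGrowth_inv (s + 1)

/-- Upper bound for the expectation of `1 / N`, from a tangent-line bound for `1 / n`. -/
theorem negbinMean_inv_le (s : ℕ) (hs : 1 ≤ s) {x : ℝ} (hx0 : 0 ≤ x) (hx1 : x < 1) :
    negbinMean s (fun k => 1 / ((s : ℝ) + 1 + k)) x
      ≤ (1 - x) * (1 / ((s : ℝ) + 1) + x / ((s : ℝ) * (s + 1))) := by
  have hx : |x| < 1 := by rwa [abs_of_nonneg hx0]
  have hs' : (1 : ℝ) ≤ s := by exact_mod_cast hs
  set c : ℝ := (1 - x) / (s + 1) with hc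
  have hi := polyGrowth_inv s
  have h1 := polyGrowth_const 1
  have hA := (polyGrowth_const ((1 - c) ^ 2)).mul hi
  have hB := (polyGrowth_const (c ^ 2)).mul h1
  have hAB : PolyGrowth (fun k : ℕ => (1 - c) ^ 2 * (1 / ((s : ℝ) + k)) + c ^ 2 * 1) := by
    refine ⟨(1 - c) ^ 2 + c ^ 2, 0, fun k => ?_⟩
    have hk : (1 : ℝ) ≤ (s : ℝ) + k := by
      have : (0 : ℝ) ≤ k := k.cast_nonneg
      linarith
    have := (div_le_one (by linarith)).2 hk
    rw [abs_of_nonneg (by positivity), pow_zero]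
    nlinarith [sq_nonneg (1 - c)]
  have hle : negbinMean s (fun k => 1 / ((s : ℝ) + 1 + k)) x
      ≤ (1 - c) ^ 2 * ((1 - x) / s) + c ^ 2 * 1 := by
    rw [← negbinMean_inv_pred s hs hx]
    have hsum := negbinMean_add hA hB s hx
    rw [negbinMean_const_mul, negbinMean_const_mul, negbinMean_one s hx] at hsum
    rw [← hsum]
    refine negbinMean_mono (polyGrowth_inv_succ s) hAB (fun k => ?_) s hx0 hx1
    have hk : (0 : ℝ) ≤ k := k.cast_nonneg
    have h0 : 0 < (s : ℝ) + k := by linarith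
    rw [mul_one, mul_one_div, div_add' _ _ _ h0.ne', div_le_div_iff₀ (by linarith) h0]
    nlinarith [sq_nonneg (c * ((s : ℝ) + 1 + k) - 1)]
  refine hle.trans ?_
  have hdiff : (1 - x) * (1 / ((s : ℝ) + 1) + x / ((s : ℝ) * (s + 1)))
      - ((1 - c) ^ 2 * ((1 - x) / s) + c ^ 2 * 1)
      = (1 - x) ^ 2 * x / ((s : ℝ) * (s + 1) ^ 2) := by
    rw [hc]
    field_simp
    ring
  have : 0 ≤ (1 - x) ^ 2 * x / ((s : ℝ) * (s + 1) ^ 2) := by positivity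
  linarith

theorem negbinMean_zero (s : ℕ) {a : ℕ → ℝ} (ha : a 0 = 0) : negbinMean s a 0 = 0 := by
  unfold negbinMean
  rw [tsum_eq_single 0 fun k hk => by simp [hk]]
  simp [ha]

theorem hasDerivAt_log_one_sub {x : ℝ} (hx : x < 1) :
    HasDerivAt (fun y => Real.log (1 - y)) (-1 / (1 - x)) x := by
  have h : HasDerivAt (fun y : ℝ => 1 - y) (-1) x := (hasDerivAt_id' x).const_sub 1
  exact h.log (by linarith)

/-- The expectation of `H (N - 1) - H s` is `-log (1 - x)`. -/
theorem negbinMean_H (s : ℕ) {x : ℝ} (hx0 : 0 ≤ x) (hx1 : x < 1) :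
    negbinMean s (fun k => H (s + k) - H s) x = -Real.log (1 - x) := by
  have hd : ∀ y ∈ Set.Icc 0 x,
      HasDerivAt (fun y => negbinMean s (fun k => H (s + k) - H s) y + Real.log (1 - y)) 0 y := by
    intro y hy
    have hy1 : y < 1 := hy.2.trans_lt hx1
    have hy' : |y| < 1 := by rwa [abs_of_nonneg hy.1]
    refine ((hasDerivAt_negbinMean (polyGrowth_H_sub s) s hy').add
      (hasDerivAt_log_one_sub hy1)).congr_deriv ?_
    have : (fun k : ℕ => ((s : ℝ) + 1 + k) * (H (s + (k + 1)) - H s - (H (s + k) - H s)))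
        = fun _ => 1 := by
      funext k
      rw [← add_assoc, H_succ]
      push_cast
      have : (s : ℝ) + k + 1 ≠ 0 := by positivity
      field_simp
      ring
    rw [this, negbinMean_one s hy']
    ring
  have h := constant_of_has_deriv_right_zero
    (fun y hy => (hd y hy).continuousAt.continuousWithinAt)
    (fun y hy => (hd y ⟨hy.1, hy.2.le⟩).hasDerivWithinAt) x ⟨hx0, le_rfl⟩
  rw [negbinMean_zero s (by simp)] at h
  simp only [sub_zero, Real.log_one, add_zero] at h
  linarith

theorem hasDerivAt_negbinMean_H_sq (s : ℕ) {x : ℝ} (hx0 : 0 ≤ x) (hx1 : x < 1) :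
    HasDerivAt (negbinMean s (fun k => (H (s + k) - H s) * (H (s + k) - H s)))
      ((2 * -Real.log (1 - x) + negbinMean s (fun k => 1 / ((s : ℝ) + 1 + k)) x) / (1 - x)) x := by
  have hx : |x| < 1 := by rwa [abs_of_nonneg hx0]
  have hH := polyGrowth_H_sub s
  refine (hasDerivAt_negbinMean (hH.mul hH) s hx).congr_deriv ?_
  rw [← negbinMean_H s hx0 hx1, ← negbinMean_const_mul,
    ← negbinMean_add ((polyGrowth_const 2).mul hH) (polyGrowth_inv_succ s) s hx]
  congr 2
  funext k
  rw [← add_assoc, H_succ]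
  push_cast
  have : (s : ℝ) + k + 1 ≠ 0 := by positivity
  have : (s : ℝ) + 1 + k ≠ 0 := by positivity
  field_simp
  ring

/-- Upper bound for the variance of `H (N - 1)`. -/
theorem negbinMean_H_sq_sub_log_sq_le (s : ℕ) (hs : 1 ≤ s) {x : ℝ} (hx0 : 0 ≤ x) (hx1 : x < 1) :
    negbinMean s (fun k => (H (s + k) - H s) * (H (s + k) - H s)) x - Real.log (1 - x) ^ 2
      ≤ x / ((s : ℝ) + 1) + x ^ 2 / (2 * (s * ((s : ℝ) + 1))) := by
  have hs' : (1 : ℝ) ≤ s := by exact_mod_cast hs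
  have hd : ∀ y ∈ Set.Icc 0 x, HasDerivAt
      (fun y => negbinMean s (fun k => (H (s + k) - H s) * (H (s + k) - H s)) y
        - Real.log (1 - y) ^ 2)
      (negbinMean s (fun k => 1 / ((s : ℝ) + 1 + k)) y / (1 - y)) y := by
    intro y hy
    have hy1 : y < 1 := hy.2.trans_lt hx1
    refine ((hasDerivAt_negbinMean_H_sq s hy.1 hy1).sub
      ((hasDerivAt_log_one_sub hy1).fun_pow 2)).congr_deriv ?_
    simp only [Nat.add_one_sub_one, pow_one, Nat.cast_ofNat]
    ring
  have hB : ∀ y : ℝ, HasDerivAt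
      (fun y : ℝ => y / ((s : ℝ) + 1) + y ^ 2 / (2 * (s * ((s : ℝ) + 1))))
      (1 / ((s : ℝ) + 1) + y / (s * ((s : ℝ) + 1))) y := by
    intro y
    refine (((hasDerivAt_id' y).div_const _).add
      ((hasDerivAt_pow 2 y).div_const _)).congr_deriv ?_
    simp only [Nat.add_one_sub_one, pow_one, Nat.cast_ofNat]
    field_simp
  refine image_le_of_deriv_right_le_deriv_boundary
    (fun y hy => (hd y hy).continuousAt.continuousWithinAt)
    (fun y hy => (hd y ⟨hy.1, hy.2.le⟩).hasDerivWithinAt) ?_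
    (fun y _ => (hB y).continuousAt.continuousWithinAt)
    (fun y _ => (hB y).hasDerivWithinAt) (fun y hy => ?_) ⟨hx0, le_rfl⟩
  · rw [negbinMean_zero s (by simp)]
    simp
  · have hy1 : y < 1 := hy.2.trans hx1
    rw [div_le_iff₀ (by linarith), mul_comm]
    exact negbinMean_inv_le s hs hy.1 hy1

theorem variance_bound_comparison {s p : ℝ} (hs : 1 ≤ s) (hp0 : 0 < p) (hp1 : p < 1) :
    (1 - p) / (s + 1) + (1 - p) ^ 2 / (2 * (s * (s + 1))) <
      (1 / (s + p)) * ((1 + p / (2 * s + 1) - 1 / (4 * (s + 1) * (2 * s + 1))) * (1 - p) +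
        p / (4 * s)) := by
  obtain ⟨t, ht, rfl⟩ : ∃ t, 0 ≤ t ∧ s = t + 1 := ⟨s - 1, by linarith, by ring⟩
  obtain ⟨q, hq0, hq1, rfl⟩ : ∃ q, 0 < q ∧ q < 1 ∧ p = 1 - q :=
    ⟨1 - p, by linarith, by linarith, by ring⟩
  have hpos : 0 < 1 - q := by linarith
  rw [← sub_pos]
  have hpoly : 0 < q * (4 * (t + 1) * (t + 2) * (1 - q) - (t + 1)
      + 2 * q * (2 * t + 3) * (t + q)) + (1 - q) * (t + 2) * (2 * t + 3) := by
    have h1 : 0 < 6 + q - 8 * q ^ 2 + 6 * q ^ 3 := by nlinarith [mul_pos hq0 hpos]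
    have h2 : 0 ≤ 7 + 4 * q - 6 * q ^ 2 + 4 * q ^ 3 := by nlinarith [mul_pos hq0 hpos]
    have h3 : 0 ≤ 2 + 2 * q := by linarith
    have := mul_nonneg ht h2
    have := mul_nonneg (sq_nonneg t) h3
    nlinarith
  have hden : 0 < 4 * (t + 1) * (t + 2) * (2 * t + 3) * (t + 1 + (1 - q)) := by positivity
  refine (div_pos hpoly hden).trans_eq ?_
  have : t + 1 + (1 - q) ≠ 0 := by positivity
  have : 2 * (t + 1) + 1 ≠ 0 := by positivity
  have : t + 1 + 1 ≠ 0 := by positivity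
  have : t + 2 ≠ 0 := by positivity
  have : 2 * t + 3 ≠ 0 := by positivity
  rw [show 2 * (t + 1) + 1 = 2 * t + 3 by ring, show t + 1 + 1 = t + 2 by ring]
  field_simp
  ring

theorem negbinExp_sq_eq (s : ℕ) {p : ℝ} (hp0 : 0 < p) (hp1 : p ≤ 1) :
    negbinExp (s + 1) p (fun n => (H s - H (n - 1) - Real.log p) ^ 2)
      = negbinMean s (fun k => (H (s + k) - H s) * (H (s + k) - H s)) (1 - p)
        - Real.log p ^ 2 := by
  have hx0 : 0 ≤ 1 - p := by linarith
  have hx1 : 1 - p < 1 := by linarith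
  have hx : |1 - p| < 1 := by rwa [abs_of_nonneg hx0]
  have hH := polyGrowth_H_sub s
  have hM := negbinMean_H s hx0 hx1
  have h1 := negbinMean_one s hx
  unfold negbinMean at hM h1 ⊢
  rw [sub_sub_cancel] at hM h1 ⊢
  have hs2 := (hH.mul hH).summable_negbin s hx
  have hs1 := hH.summable_negbin s hx
  have hs0 := (polyGrowth_const 1).summable_negbin s hx
  have hsum : negbinExp (s + 1) p (fun n => (H s - H (n - 1) - Real.log p) ^ 2)
      = p ^ (s + 1) * ∑' k : ℕ, ((s + k).choose s : ℝ)
          * ((H (s + k) - H s) * (H (s + k) - H s)) * (1 - p) ^ k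
        + 2 * Real.log p * (p ^ (s + 1) * ∑' k : ℕ, ((s + k).choose s : ℝ)
          * (H (s + k) - H s) * (1 - p) ^ k)
        + Real.log p ^ 2 * (p ^ (s + 1) * ∑' k : ℕ, ((s + k).choose s : ℝ)
          * 1 * (1 - p) ^ k) := by
    unfold negbinExp
    simp only [← tsum_mul_left]
    rw [← (hs2.mul_left _).tsum_add ((hs1.mul_left _).mul_left _),
      ← ((hs2.mul_left _).add ((hs1.mul_left _).mul_left _)).tsum_add
        ((hs0.mul_left _).mul_left _)]
    refine tsum_congr fun k => ?_
    rw [show s + 1 + k - 1 = s + k by omega, Nat.add_sub_cancel]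
    ring
  rw [hsum, hM, h1]
  ring

theorem log_p_estimator_variance_bound (r : ℕ) (hr : 2 ≤ r) (p : ℝ)
    (hp0 : 0 < p) (hp1 : p < 1) :
    negbinExp r p (fun n => (H (r - 1) - H (n - 1) - Real.log p) ^ 2) <
      (1 / ((r : ℝ) - 1 + p)) *
        ((1 + p / (2 * (r : ℝ) - 1) - 1 / (4 * (r : ℝ) * (2 * (r : ℝ) - 1))) * (1 - p) +
          p / (4 * ((r : ℝ) - 1))) := by
  obtain ⟨s, rfl⟩ : ∃ s, r = s + 1 := ⟨r - 1, by omega⟩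
  have hs : 1 ≤ s := by omega
  have hV := negbinMean_H_sq_sub_log_sq_le s hs (x := 1 - p) (by linarith) (by linarith)
  rw [sub_sub_cancel, ← negbinExp_sq_eq s hp0 hp1.le] at hV
  have hC := variance_bound_comparison (s := s) (by exact_mod_cast hs) hp0 hp1
  rw [Nat.add_sub_cancel]
  push_cast
  rw [add_sub_cancel_right, show 2 * ((s : ℝ) + 1) - 1 = 2 * s + 1 by ring]
  exact hV.trans_lt hC
end

section
/- Let r ∈ ℕ with r ≥ 2 and p ∈ (0,1), and let N be negative binomial with parameters r and p. Then the variance of the unbiased estimator λ̂ = −H_{N−1} + H_{r−1} of log p, namely Var[λ̂] = Σ_{n≥r} C(n−1, r−1) p^r (1−p)^{n−r} (H_{r−1} − H_{n−1} − log p)², satisfies Var[λ̂] < 1/(r−1). -/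
open scoped BigOperators

/-- The derivative of the truncated second moment of `H (r - 1) - H (N - 1) - log x` about zero,
where `r = n + 2`. The terms telescope up to a nonnegative boundary term. -/
theorem hasDerivAt_truncated_moment (n M : ℕ) {x : ℝ} (hx : 0 < x) :
    HasDerivAt (fun x : ℝ => ∑ k ∈ Finset.range M, ((n + 1 + k).choose (n + 1) : ℝ) *
        x ^ (n + 2) * (1 - x) ^ k * (H (n + 1) - H (n + 1 + k) - Real.log x) ^ 2)
      ((M : ℝ) * ((n + 1 + M).choose (n + 1) : ℝ) * x ^ (n + 1) * (1 - x) ^ (M - 1) *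
          (H (n + 1) - H (n + 1 + M) - Real.log x) ^ 2 -
        ∑ k ∈ Finset.range M, ((n + 1 + k).choose (n + 1) : ℝ) *
          x ^ (n + 1) * (1 - x) ^ k / ((n : ℝ) + 2 + k)) x := by
  induction M with
  | zero => simpa using hasDerivAt_const x (0 : ℝ)
  | succ M ih =>
    simp only [Finset.sum_range_succ]
    have hpow := ((hasDerivAt_id x).const_sub 1).pow M
    have hlog := ((Real.hasDerivAt_log hx.ne').const_sub (H (n + 1) - H (n + 1 + M))).pow 2
    have hterm := (((hasDerivAt_pow (n + 2) x).const_mul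
      ((n + 1 + M).choose (n + 1) : ℝ)).mul hpow).mul hlog
    refine (ih.add hterm).congr_deriv ?_
    have hchoose : ((M : ℝ) + 1) * ((n + 1 + (M + 1)).choose (n + 1) : ℝ) =
        ((n + 1 + M).choose (n + 1) : ℝ) * ((n : ℝ) + 2 + M) := by
      have h := Nat.choose_mul_succ_eq (n + 1 + M) (n + 1)
      rw [show n + 1 + M + 1 - (n + 1) = M + 1 by omega] at h
      have h' : ((n + 1 + M).choose (n + 1) : ℝ) * ((n : ℝ) + 1 + M + 1) =
          ((n + 1 + (M + 1)).choose (n + 1) : ℝ) * ((M : ℝ) + 1) := by exact_mod_cast h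
      linear_combination -h'
    have hH : H (n + 1 + (M + 1)) = H (n + 1 + M) + 1 / ((n : ℝ) + 2 + M) := by
      rw [← add_assoc, H_succ]
      push_cast
      ring
    have hM : (M : ℝ) * (1 - x) ^ M = M * (1 - x) ^ (M - 1) * (1 - x) := by
      cases M with
      | zero => simp
      | succ M => simp [pow_succ, mul_assoc]
    have hd : (n : ℝ) + 2 + M ≠ 0 := by positivity
    simp only [id, Pi.pow_apply, Pi.mul_apply, Nat.add_sub_cancel]
    push_cast
    rw [hchoose, hH]
    generalize H (n + 1) = a
    generalize H (n + 1 + M) = b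
    generalize ((n + 1 + M).choose (n + 1) : ℝ) = c
    generalize Real.log x = l
    generalize (∑ k ∈ Finset.range M, ((n + 1 + k).choose (n + 1) : ℝ) *
          x ^ (n + 1) * (1 - x) ^ k / ((n : ℝ) + 2 + k)) = S
    generalize (1 - x) ^ (M - 1) = u at *
    generalize (1 - x) ^ M = v at *
    rw [pow_succ x (n + 1)]
    generalize x ^ (n + 1) = y
    have hxne := hx.ne'
    field_simp
    linear_combination (-c * y * (a - b - l) ^ 2 * ((n : ℝ) + 2 + M)) * hM

/-- Truncations of `E[1 / N]` for `N` negative binomial with parameters `n + 2` and `x` are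
at most `x / (n + 1)`; both sides are divided by `x`. -/
theorem truncated_inverse_moment_le (n M : ℕ) {x : ℝ} (hx : 0 < x) (hx1 : x < 1) :
    ∑ k ∈ Finset.range M, ((n + 1 + k).choose (n + 1) : ℝ) *
      x ^ (n + 1) * (1 - x) ^ k / ((n : ℝ) + 2 + k) ≤ 1 / ((n : ℝ) + 1) := by
  have hx' : 0 < 1 - x := sub_pos.2 hx1
  have hs := hasSum_choose_mul_geometric_of_norm_lt_one (𝕜 := ℝ) n (r := 1 - x)
    (by rw [Real.norm_eq_abs, abs_of_pos hx']; linarith)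
  have hle := sum_le_hasSum (Finset.range M) (fun k _ => by positivity) hs
  rw [sub_sub_cancel] at hle
  calc _ ≤ ∑ k ∈ Finset.range M,
        (x ^ (n + 1) / ((n : ℝ) + 1)) * (((k + n).choose n : ℝ) * (1 - x) ^ k) := by
        refine Finset.sum_le_sum fun k _ => ?_
        have h := Nat.add_one_mul_choose_eq (k + n) n
        have h' : ((k : ℝ) + n + 1) * ((k + n).choose n : ℝ) =
            ((n + 1 + k).choose (n + 1) : ℝ) * ((n : ℝ) + 1) := by
          rw [show n + 1 + k = k + n + 1 by omega]
          exact_mod_cast h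
        have hc : ((n + 1 + k).choose (n + 1) : ℝ) =
            ((k : ℝ) + n + 1) * ((k + n).choose n : ℝ) / ((n : ℝ) + 1) := by
          rw [h']
          field_simp
        rw [hc, div_le_iff₀ (by positivity)]
        have hpos : 0 ≤ x ^ (n + 1) / ((n : ℝ) + 1) * (((k + n).choose n : ℝ) * (1 - x) ^ k) := by
          positivity
        calc _ = x ^ (n + 1) / ((n : ℝ) + 1) * (((k + n).choose n : ℝ) * (1 - x) ^ k) *
              ((k : ℝ) + n + 1) := by ring
          _ ≤ _ := mul_le_mul_of_nonneg_left (by linarith) hpos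
    _ ≤ x ^ (n + 1) / ((n : ℝ) + 1) * (1 / x ^ (n + 1)) := by
        rw [← Finset.mul_sum]
        exact mul_le_mul_of_nonneg_left hle (by positivity)
    _ = 1 / ((n : ℝ) + 1) := by field_simp

theorem truncated_moment_le (n M : ℕ) {p : ℝ} (hp0 : 0 < p) (hp1 : p < 1) :
    ∑ k ∈ Finset.range M, ((n + 1 + k).choose (n + 1) : ℝ) * p ^ (n + 2) * (1 - p) ^ k *
      (H (n + 1) - H (n + 1 + k) - Real.log p) ^ 2 ≤ (1 - p) / ((n : ℝ) + 1) := by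
  have hderiv (x : ℝ) (hx : 0 < x) := (hasDerivAt_truncated_moment n M hx).add
    ((hasDerivAt_id x).div_const ((n : ℝ) + 1))
  have hmono := monotoneOn_of_deriv_nonneg (convex_Icc p 1)
    (fun x hx => (hderiv x (hp0.trans_le hx.1)).continuousAt.continuousWithinAt)
    (fun x hx => by
      rw [interior_Icc] at hx
      exact (hderiv x (hp0.trans hx.1)).differentiableAt.differentiableWithinAt)
    (fun x hx => by
      rw [interior_Icc] at hx
      have hx0 : 0 < x := hp0.trans hx.1
      have hx' : 0 < 1 - x := sub_pos.2 hx.2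
      rw [(hderiv x hx0).deriv]
      have h1 := truncated_inverse_moment_le n M hx0 hx.2
      have h2 : 0 ≤ (M : ℝ) * ((n + 1 + M).choose (n + 1) : ℝ) * x ^ (n + 1) *
          (1 - x) ^ (M - 1) * (H (n + 1) - H (n + 1 + M) - Real.log x) ^ 2 := by positivity
      linarith)
  have h := hmono (Set.left_mem_Icc.2 hp1.le) (Set.right_mem_Icc.2 hp1.le) hp1.le
  have hone : ∑ k ∈ Finset.range M, ((n + 1 + k).choose (n + 1) : ℝ) * 1 ^ (n + 2) *
      (1 - 1) ^ k * (H (n + 1) - H (n + 1 + k) - Real.log 1) ^ 2 = 0 := by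
    refine Finset.sum_eq_zero fun k _ => ?_
    cases k <;> simp
  simp only [Pi.add_apply, id] at h
  rw [hone] at h
  rw [sub_div]
  linarith

theorem log_p_estimator_variance_bound_guar (r : ℕ) (hr : 2 ≤ r) (p : ℝ)
    (hp0 : 0 < p) (hp1 : p < 1) :
    negbinExp r p (fun n => (H (r - 1) - H (n - 1) - Real.log p) ^ 2) <
      1 / ((r : ℝ) - 1) := by
  obtain ⟨n, rfl⟩ := Nat.exists_eq_add_of_le' hr
  have hp' : 0 < 1 - p := sub_pos.2 hp1
  have hcast : ((n + 2 : ℕ) : ℝ) - 1 = (n : ℝ) + 1 := by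
    push_cast
    ring
  have hindex (k : ℕ) : n + 2 + k - 1 = n + 1 + k := by omega
  rw [hcast]
  simp only [negbinExp, hindex, show n + 2 - 1 = n + 1 by omega]
  refine (Real.tsum_le_of_sum_range_le (fun k => by positivity)
    fun M => truncated_moment_le n M hp0 hp1).trans_lt ?_
  gcongr
  linarith
end

section
/- Let r ∈ ℕ with r ≥ 2 and p ∈ (0,1). Let N₁ be negative binomial with parameters r and p, and N₂ be negative binomial with parameters r and 1−p, independent, and let δ̂ = −H_{N₁−1} + H_{N₂−1}. Then Var[δ̂] = E[(δ̂ − log(p/(1−p)))²] satisfies Var[δ̂] < (r² − r/4 − 1/4)/((r−1+p)(r−p)(r−1/2)) − (p(1−p)/(r−1/2)²)·(1 − 1/(2r−3)), where the expectation is the double series over n₁ ≥ r and n₂ ≥ r weighted by the negative binomial probabilities. -/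
open scoped BigOperators

theorem summable_mul_pow_of_abs_le_pow {a : ℕ → ℝ} {N e : ℕ}
    (ha : ∀ k, |a k| ≤ ((k : ℝ) + N) ^ e) {x : ℝ} (hx : |x| < 1) :
    Summable fun k => a k * x ^ k := by
  obtain ⟨ρ, hxρ, hρ1⟩ := exists_between hx
  have hρ0 : 0 < ρ := (abs_nonneg x).trans_lt hxρ
  have hs : Summable fun k : ℕ => ((k + N : ℕ) : ℝ) ^ e * ρ ^ (k + N) :=
    (summable_nat_add_iff N (f := fun k : ℕ => (k : ℝ) ^ e * ρ ^ k)).2 (summable_pow_mul_geometric_of_norm_lt_one e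
    (show ‖ρ‖ < 1 by rwa [Real.norm_of_nonneg hρ0.le]))
  refine Summable.of_norm_bounded (g := fun k : ℕ => ((k : ℝ) + N) ^ e * ρ ^ k)
    ((hs.mul_left (ρ ^ N)⁻¹).congr fun k => ?_) fun k => ?_
  · have hN : ρ ^ N ≠ 0 := (pow_pos hρ0 N).ne'
    rw [Nat.cast_add, pow_add ρ k N, mul_left_comm, mul_comm (ρ ^ k), inv_mul_cancel_left₀ hN]
  · rw [norm_mul, norm_pow, Real.norm_eq_abs, Real.norm_eq_abs]
    exact mul_le_mul (ha k) (pow_le_pow_left₀ (abs_nonneg x) hxρ.le k) (by positivity)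
      (by positivity)

theorem hasDerivAt_tsum_mul_pow {a : ℕ → ℝ} {N e : ℕ}
    (ha : ∀ k, |a k| ≤ ((k : ℝ) + N) ^ e) {x : ℝ} (hx : |x| < 1) :
    HasDerivAt (fun y => ∑' k, a k * y ^ k) (∑' k : ℕ, ((k : ℝ) + 1) * a (k + 1) * x ^ k) x := by
  obtain ⟨ρ, hxρ, hρ1⟩ := exists_between hx
  have hρ0 : 0 < ρ := (abs_nonneg x).trans_lt hxρ
  have hshift : ∀ {y : ℝ}, |y| < 1 → Summable fun k : ℕ => ((k : ℝ) + 1) * a (k + 1) * y ^ k := by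
    intro y hy
    refine summable_mul_pow_of_abs_le_pow (N := N + 1) (e := e + 1) (fun k => ?_) hy
    rw [abs_mul, abs_of_nonneg (by positivity), pow_succ, mul_comm]
    have h := ha (k + 1)
    push_cast at h ⊢
    calc |a (k + 1)| * ((k : ℝ) + 1) ≤ ((k : ℝ) + 1 + N) ^ e * (k + (N + 1)) := by
          gcongr
          linarith [(Nat.cast_nonneg N : (0 : ℝ) ≤ N)]
      _ = _ := by ring
  have hdom : Summable fun k : ℕ => |a k| * (k * ρ ^ (k - 1)) := by
    rw [← summable_nat_add_iff 1]
    refine (hshift (y := ρ) (by rwa [abs_of_pos hρ0])).abs.congr fun k => ?_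
    rw [abs_mul, abs_mul, abs_of_nonneg (by positivity : (0 : ℝ) ≤ (k : ℝ) + 1),
      abs_of_nonneg (by positivity : 0 ≤ ρ ^ k)]
    rw [Nat.add_sub_cancel]
    push_cast
    ring
  have key : HasDerivAt (fun y => ∑' k, a k * y ^ k) (∑' k : ℕ, a k * (k * x ^ (k - 1))) x := by
    refine hasDerivAt_tsum_of_isPreconnected (t := Metric.ball 0 ρ) (y₀ := 0) hdom
      Metric.isOpen_ball (convex_ball _ _).isPreconnected
      (fun k y _ => (hasDerivAt_pow k y).const_mul (a k)) (fun k y hy => ?_)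
      (Metric.mem_ball_self hρ0) (summable_mul_pow_of_abs_le_pow ha (by simp)) (by simpa using hxρ)
    rw [mem_ball_zero_iff, Real.norm_eq_abs] at hy
    rw [norm_mul, norm_mul, norm_pow, Real.norm_natCast, Real.norm_eq_abs, Real.norm_eq_abs]
    gcongr
  convert key using 1
  have hs : Summable fun k : ℕ => a k * (k * x ^ (k - 1)) := by
    rw [← summable_nat_add_iff 1]
    refine (hshift hx).congr fun k => ?_
    rw [Nat.add_sub_cancel]
    push_cast
    ring
  rw [hs.tsum_eq_zero_add]
  simp only [Nat.cast_zero, zero_mul, mul_zero, zero_add]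
  refine tsum_congr fun k => ?_
  rw [Nat.add_sub_cancel]
  push_cast
  ring

/-- Probability of `k` failures before the `(d + 2)`-th success, where `x` is the failure
probability. -/
noncomputable def negbinWeight (d : ℕ) (x : ℝ) (k : ℕ) : ℝ :=
  ((k + (d + 1)).choose (d + 1) : ℝ) * (1 - x) ^ (d + 2) * x ^ k

theorem negbinWeight_nonneg (d : ℕ) {x : ℝ} (hx0 : 0 ≤ x) (hx1 : x < 1) (k : ℕ) :
    0 ≤ negbinWeight d x k := by
  have : 0 < 1 - x := by linarith
  unfold negbinWeight
  positivity

theorem abs_choose_mul_le {d : ℕ} {f : ℕ → ℝ} (hf : ∀ k, |f k| ≤ ((k : ℝ) + (d + 1 : ℕ)) ^ 2)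
    (k : ℕ) :
    |((k + (d + 1)).choose (d + 1) : ℝ) * f k| ≤ ((k : ℝ) + (d + 1 : ℕ)) ^ (d + 3) := by
  rw [abs_mul, Nat.abs_cast, show d + 3 = (d + 1) + 2 by ring, pow_add]
  gcongr
  · exact_mod_cast Nat.choose_le_pow _ _
  · exact hf k

theorem summable_negbinWeight_mul {d : ℕ} {f : ℕ → ℝ}
    (hf : ∀ k, |f k| ≤ ((k : ℝ) + (d + 1 : ℕ)) ^ 2) {x : ℝ} (hx : |x| < 1) :
    Summable fun k => negbinWeight d x k * f k := by
  refine ((summable_mul_pow_of_abs_le_pow (abs_choose_mul_le hf) hx).mul_left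
    ((1 - x) ^ (d + 2))).congr fun k => ?_
  unfold negbinWeight
  ring

theorem hasSum_negbinWeight (d : ℕ) {x : ℝ} (hx : |x| < 1) : HasSum (negbinWeight d x) 1 := by
  have h := (hasSum_choose_mul_geometric_of_norm_lt_one (d + 1) (r := x) hx).mul_left
    ((1 - x) ^ (d + 2))
  have hx' : 1 - x ≠ 0 := by linarith [(abs_lt.1 hx).2]
  have h1 : (1 - x) ^ (d + 2) * (1 / (1 - x) ^ (d + 1 + 1)) = 1 := by field_simp
  rw [h1] at h
  refine h.congr_fun fun k => ?_
  unfold negbinWeight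
  ring

/-- The derivative of a negative binomial expectation with respect to the failure probability. -/
theorem hasDerivAt_tsum_negbinWeight_mul {d : ℕ} {f : ℕ → ℝ}
    (hf : ∀ k, |f k| ≤ ((k : ℝ) + (d + 1 : ℕ)) ^ 2) {x : ℝ} (hx : |x| < 1) :
    HasDerivAt (fun y => ∑' k, negbinWeight d y k * f k)
      ((∑' k, negbinWeight d x k * (((k : ℝ) + d + 2) * (f (k + 1) - f k))) / (1 - x)) x := by
  set a : ℕ → ℝ := fun k => ((k + (d + 1)).choose (d + 1) : ℝ) * f k with ha
  have hab := abs_choose_mul_le hf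
  have hG := hasDerivAt_tsum_mul_pow (a := a) hab hx
  have hx' : 1 - x ≠ 0 := by linarith [(abs_lt.1 hx).2]
  have hE : (fun y => ∑' k, negbinWeight d y k * f k) =
      fun y => (1 - y) ^ (d + 2) * ∑' k, a k * y ^ k := by
    ext y
    rw [← tsum_mul_left]
    refine tsum_congr fun k => ?_
    simp only [negbinWeight, ha]
    ring
  have hsa : Summable fun k => a k * x ^ k := summable_mul_pow_of_abs_le_pow hab hx
  have hsb : Summable fun k : ℕ => ((k : ℝ) + 1) * a (k + 1) * x ^ k := by
    refine summable_mul_pow_of_abs_le_pow (N := d + 2) (e := d + 4) (fun k => ?_) hx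
    have h := hab (k + 1)
    rw [abs_mul, abs_of_nonneg (by positivity), pow_succ, mul_comm]
    push_cast at h ⊢
    calc |a (k + 1)| * ((k : ℝ) + 1) ≤ ((k : ℝ) + 1 + (d + 1)) ^ (d + 3) * (k + (d + 2)) := by
          refine mul_le_mul (by simpa [ha] using h) ?_ (by positivity) (by positivity)
          linarith [(Nat.cast_nonneg d : (0 : ℝ) ≤ d)]
      _ = _ := by ring
  have hsc : Summable fun k : ℕ => (k : ℝ) * a k * x ^ k := by
    rw [← summable_nat_add_iff 1]
    refine (hsb.mul_left x).congr fun k => ?_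
    push_cast
    ring
  have hc : ∑' k : ℕ, (k : ℝ) * a k * x ^ k = x * ∑' k : ℕ, ((k : ℝ) + 1) * a (k + 1) * x ^ k := by
    rw [hsc.tsum_eq_zero_add, ← tsum_mul_left]
    simp only [Nat.cast_zero, zero_mul, zero_add]
    refine tsum_congr fun k => ?_
    push_cast
    ring
  have hD : ∑' k, negbinWeight d x k * (((k : ℝ) + d + 2) * (f (k + 1) - f k)) =
      (1 - x) ^ (d + 2) * ((1 - x) * ∑' k : ℕ, ((k : ℝ) + 1) * a (k + 1) * x ^ k -
        (d + 2) * ∑' k, a k * x ^ k) := by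
    rw [show ∀ S T : ℝ, (1 - x) * S - (d + 2) * T = S - x * S - (d + 2) * T by intros; ring, ← hc,
      ← hsb.tsum_sub hsc, ← tsum_mul_left, ← (hsb.sub hsc).tsum_sub (hsa.mul_left _),
      ← tsum_mul_left]
    refine tsum_congr fun k => ?_
    have hch : ((k : ℝ) + 1) * ((k + 1 + (d + 1)).choose (d + 1) : ℝ) =
        ((k : ℝ) + d + 2) * ((k + (d + 1)).choose (d + 1) : ℝ) := by
      have h := Nat.choose_mul_succ_eq (k + (d + 1)) (d + 1)
      rw [show k + (d + 1) + 1 - (d + 1) = k + 1 by omega,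
        show k + (d + 1) + 1 = k + 1 + (d + 1) by omega] at h
      have h' : (((k + (d + 1)).choose (d + 1) : ℕ) : ℝ) * ((k + 1 + (d + 1) : ℕ) : ℝ) =
        (((k + 1 + (d + 1)).choose (d + 1) : ℕ) : ℝ) * ((k + 1 : ℕ) : ℝ) := by exact_mod_cast h
      push_cast at h'
      linarith
    simp only [negbinWeight, ha]
    linear_combination (-(1 - x) ^ (d + 2) * x ^ k * f (k + 1)) * hch
  rw [hE, hD]
  have h1 : HasDerivAt (fun y : ℝ => (1 - y) ^ (d + 2)) (-((d + 2) * (1 - x) ^ (d + 1))) x := by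
    have h := ((hasDerivAt_id x).const_sub 1).pow (d + 2)
    refine h.congr_deriv ?_
    simp
  refine (h1.mul hG).congr_deriv ?_
  field_simp
  ring

theorem H_nonneg (m : ℕ) : 0 ≤ H m := Finset.sum_nonneg fun _ _ => by positivity

theorem H_le (m : ℕ) : H m ≤ m := by
  induction m with
  | zero => simp [H]
  | succ m ih =>
    rw [H_succ]
    push_cast
    have : 1 / ((m : ℝ) + 1) ≤ 1 := by
      rw [div_le_one (by positivity)]
      linarith [(Nat.cast_nonneg m : (0 : ℝ) ≤ m)]
    linarith

theorem abs_H_le (d k : ℕ) : |H (k + (d + 1))| ≤ ((k : ℝ) + (d + 1 : ℕ)) ^ 2 := by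
  rw [abs_of_nonneg (H_nonneg _)]
  have h := H_le (k + (d + 1))
  push_cast at h ⊢
  nlinarith [(Nat.cast_nonneg d : (0 : ℝ) ≤ d), (Nat.cast_nonneg k : (0 : ℝ) ≤ k)]

theorem abs_H_sq_le (d k : ℕ) : |H (k + (d + 1)) ^ 2| ≤ ((k : ℝ) + (d + 1 : ℕ)) ^ 2 := by
  rw [abs_of_nonneg (sq_nonneg _)]
  have h := H_le (k + (d + 1))
  push_cast at h ⊢
  exact pow_le_pow_left₀ (H_nonneg _) h 2

theorem abs_one_div_le (d k : ℕ) : |1 / ((k : ℝ) + d + 2)| ≤ ((k : ℝ) + (d + 1 : ℕ)) ^ 2 := by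
  have hd := (Nat.cast_nonneg d : (0 : ℝ) ≤ d)
  have hk := (Nat.cast_nonneg k : (0 : ℝ) ≤ k)
  rw [abs_of_nonneg (by positivity)]
  push_cast
  calc 1 / ((k : ℝ) + d + 2) ≤ 1 := by
        rw [div_le_one (by positivity)]
        linarith
    _ ≤ _ := by nlinarith

theorem tsum_negbinWeight_zero_mul (d : ℕ) (f : ℕ → ℝ) :
    ∑' k, negbinWeight d 0 k * f k = f 0 := by
  rw [tsum_eq_single 0 (fun k hk => by simp [negbinWeight, hk])]
  simp [negbinWeight]

theorem tsum_negbinWeight_mul_H (d : ℕ) {x : ℝ} (hx0 : 0 ≤ x) (hx1 : x < 1) :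
    ∑' k, negbinWeight d x k * H (k + (d + 1)) = H (d + 1) - Real.log (1 - x) := by
  have hd : ∀ y ∈ Set.Icc 0 x, HasDerivAt
      (fun y => (∑' k, negbinWeight d y k * H (k + (d + 1))) + Real.log (1 - y)) 0 y := by
    intro y hy
    have hy1 : y < 1 := hy.2.trans_lt hx1
    have hya : |y| < 1 := by rwa [abs_of_nonneg hy.1]
    refine ((hasDerivAt_tsum_negbinWeight_mul (abs_H_le d) hya).add
      (hasDerivAt_log_one_sub hy1)).congr_deriv ?_
    have : ∀ k : ℕ, ((k : ℝ) + d + 2) * (H (k + 1 + (d + 1)) - H (k + (d + 1))) = 1 := by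
      intro k
      rw [show k + 1 + (d + 1) = k + (d + 1) + 1 by ring, H_succ]
      push_cast
      field_simp
      ring
    simp only [this, mul_one, (hasSum_negbinWeight d hya).tsum_eq]
    ring
  have hc := constant_of_has_deriv_right_zero
    (fun y hy => (hd y hy).continuousAt.continuousWithinAt)
    (fun y hy => (hd y (Set.Ico_subset_Icc_self hy)).hasDerivWithinAt) x ⟨hx0, le_rfl⟩
  rw [tsum_negbinWeight_zero_mul d fun k => H (k + (d + 1))] at hc
  simp only [sub_zero, Real.log_one, zero_add] at hc
  linarith

theorem hasSum_negbinWeight_mul_one_div (d : ℕ) {x : ℝ} (hx : |x| < 1) :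
    HasSum (fun k : ℕ => negbinWeight d x k * (1 / ((k : ℝ) + d + 1))) ((1 - x) / (d + 1)) := by
  have hx' : 1 - x ≠ 0 := by linarith [(abs_lt.1 hx).2]
  have hsum := (hasSum_choose_mul_geometric_of_norm_lt_one d (r := x) hx).mul_left
    ((1 - x) ^ (d + 2) / (d + 1))
  have hval : (1 - x) ^ (d + 2) / ((d : ℝ) + 1) * (1 / (1 - x) ^ (d + 1)) =
      (1 - x) / (d + 1) := by
    field_simp
    ring
  rw [hval] at hsum
  refine hsum.congr_fun fun k => ?_
  have h := Nat.add_one_mul_choose_eq (k + d) d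
  have h' : ((k : ℝ) + d + 1) * (((k + d).choose d : ℕ) : ℝ) =
      (((k + (d + 1)).choose (d + 1) : ℕ) : ℝ) * (d + 1) := by exact_mod_cast h
  unfold negbinWeight
  field_simp
  linear_combination (-(x ^ k)) * h'

theorem tsum_negbinWeight_mul_one_div_le (d : ℕ) {x : ℝ} (hx0 : 0 ≤ x) (hx1 : x < 1) :
    ∑' k : ℕ, negbinWeight d x k * (1 / ((k : ℝ) + d + 2)) ≤ (1 - x) / (d + 2 - x) := by
  have hxa : |x| < 1 := by rwa [abs_of_nonneg hx0]
  have hd := (Nat.cast_nonneg d : (0 : ℝ) ≤ d)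
  have hc : 0 < (d : ℝ) + 2 - x := by linarith
  -- `1 / n ≤ (1 - u)² / (n - 1) + u²` is the tangent-line form of Jensen's inequality.
  set u : ℝ := (1 - x) / (d + 2 - x) with hu
  have hs := ((hasSum_negbinWeight_mul_one_div d hxa).mul_left ((1 - u) ^ 2)).add
    ((hasSum_negbinWeight d hxa).mul_left (u ^ 2))
  refine (hasSum_le (fun k => ?_)
    (summable_negbinWeight_mul (abs_one_div_le d) hxa).hasSum hs).trans (le_of_eq ?_)
  · have hk := (Nat.cast_nonneg k : (0 : ℝ) ≤ k)
    have hpt : 1 / ((k : ℝ) + d + 2) ≤ (1 - u) ^ 2 * (1 / ((k : ℝ) + d + 1)) + u ^ 2 := by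
      rw [← sub_nonneg]
      have : (1 - u) ^ 2 * (1 / ((k : ℝ) + d + 1)) + u ^ 2 - 1 / ((k : ℝ) + d + 2) =
          (1 - u * ((k : ℝ) + d + 2)) ^ 2 / (((k : ℝ) + d + 1) * ((k : ℝ) + d + 2)) := by
        field_simp
        ring
      rw [this]
      positivity
    have := mul_le_mul_of_nonneg_left hpt (negbinWeight_nonneg d hx0 hx1 k)
    linarith
  · rw [hu]
    field_simp
    ring

theorem tsum_negbinWeight_mul_H_sq_le (d : ℕ) {x : ℝ} (hx0 : 0 ≤ x) (hx1 : x < 1) :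
    ∑' k, negbinWeight d x k * H (k + (d + 1)) ^ 2 ≤
      (H (d + 1) - Real.log (1 - x)) ^ 2 + x / (d + 2 - x) := by
  have hdn := (Nat.cast_nonneg d : (0 : ℝ) ≤ d)
  have hd : ∀ y ∈ Set.Icc 0 x, HasDerivAt
      (fun y => (∑' k, negbinWeight d y k * H (k + (d + 1)) ^ 2) -
        (H (d + 1) - Real.log (1 - y)) ^ 2)
      ((∑' k : ℕ, negbinWeight d y k * (1 / ((k : ℝ) + d + 2))) / (1 - y)) y := by
    intro y hy
    have hy1 : y < 1 := hy.2.trans_lt hx1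
    have hya : |y| < 1 := by rwa [abs_of_nonneg hy.1]
    refine ((hasDerivAt_tsum_negbinWeight_mul (abs_H_sq_le d) hya).sub
      (((hasDerivAt_log_one_sub hy1).const_sub (H (d + 1))).pow 2)).congr_deriv ?_
    have hstep : ∀ k : ℕ, negbinWeight d y k *
        (((k : ℝ) + d + 2) * (H (k + 1 + (d + 1)) ^ 2 - H (k + (d + 1)) ^ 2)) =
        2 * (negbinWeight d y k * H (k + (d + 1))) +
          negbinWeight d y k * (1 / ((k : ℝ) + d + 2)) := by
      intro k
      rw [show k + 1 + (d + 1) = k + (d + 1) + 1 by ring, H_succ]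
      push_cast
      rw [show (k : ℝ) + (d + 1) + 1 = k + d + 2 by ring]
      field_simp
      ring
    simp only [hstep]
    rw [((summable_negbinWeight_mul (abs_H_le d) hya).mul_left 2).tsum_add
      (summable_negbinWeight_mul (abs_one_div_le d) hya), tsum_mul_left,
      tsum_negbinWeight_mul_H d hy.1 hy1]
    push_cast
    ring
  have h := image_le_of_deriv_right_le_deriv_boundary
    (f := fun y => (∑' k, negbinWeight d y k * H (k + (d + 1)) ^ 2) -
      (H (d + 1) - Real.log (1 - y)) ^ 2)
    (B := fun y => y / (d + 2 - x)) (B' := fun _ => 1 / (d + 2 - x))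
    (fun y hy => (hd y hy).continuousAt.continuousWithinAt)
    (fun y hy => (hd y (Set.Ico_subset_Icc_self hy)).hasDerivWithinAt)
    (by
      rw [tsum_negbinWeight_zero_mul d fun k => H (k + (d + 1)) ^ 2]
      simp)
    (by fun_prop) (fun y _ => ((hasDerivAt_id y).div_const _).hasDerivWithinAt)
    (fun y hy => by
      have hy1 : y < 1 := hy.2.trans hx1
      have hp : 0 < 1 - y := by linarith
      rw [div_le_iff₀ hp]
      refine (tsum_negbinWeight_mul_one_div_le d hy.1 hy1).trans ?_
      rw [one_div_mul_eq_div]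
      exact div_le_div_of_nonneg_left hp.le (by linarith) (by linarith [hy.2]))
    (x := x) ⟨hx0, le_rfl⟩
  linarith

theorem hasSum_negbinWeight_mul_centered (d : ℕ) {x : ℝ} (hx0 : 0 ≤ x) (hx1 : x < 1) :
    HasSum (fun k => negbinWeight d x k *
      (H (k + (d + 1)) - (H (d + 1) - Real.log (1 - x)))) 0 := by
  have hxa : |x| < 1 := by rwa [abs_of_nonneg hx0]
  have h1 := (summable_negbinWeight_mul (abs_H_le d) hxa).hasSum
  rw [tsum_negbinWeight_mul_H d hx0 hx1] at h1
  have h := h1.sub ((hasSum_negbinWeight d hxa).mul_right (H (d + 1) - Real.log (1 - x)))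
  rw [one_mul, sub_self] at h
  refine h.congr_fun fun k => ?_
  ring

theorem exists_hasSum_negbinWeight_mul_centered_sq (d : ℕ) {x : ℝ} (hx0 : 0 ≤ x) (hx1 : x < 1) :
    ∃ v ≤ x / (d + 2 - x), HasSum (fun k => negbinWeight d x k *
      (H (k + (d + 1)) - (H (d + 1) - Real.log (1 - x))) ^ 2) v := by
  have hxa : |x| < 1 := by rwa [abs_of_nonneg hx0]
  set μ := H (d + 1) - Real.log (1 - x) with hμ
  have h := ((summable_negbinWeight_mul (abs_H_sq_le d) hxa).hasSum.sub
    ((hasSum_negbinWeight_mul_centered d hx0 hx1).mul_left (2 * μ))).sub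
    ((hasSum_negbinWeight d hxa).mul_left (μ ^ 2))
  refine ⟨_, ?_, h.congr_fun ?_⟩
  · linarith [tsum_negbinWeight_mul_H_sq_le d hx0 hx1]
  · intro k
    ring

/-- The variance of the difference of two independent variables, as an iterated sum. -/
theorem tsum_tsum_mul_sub_sq {w₁ w₂ a b : ℕ → ℝ} {v₁ v₂ : ℝ} (h₁ : HasSum w₁ 1)
    (h₂ : HasSum w₂ 1) (hb : HasSum (fun k => w₂ k * b k) 0)
    (ha2 : HasSum (fun k => w₁ k * a k ^ 2) v₁) (hb2 : HasSum (fun k => w₂ k * b k ^ 2) v₂) :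
    ∑' i, ∑' j, w₁ i * w₂ j * (b j - a i) ^ 2 = v₁ + v₂ := by
  have hin : ∀ i, ∑' j, w₁ i * w₂ j * (b j - a i) ^ 2 = w₁ i * a i ^ 2 + w₁ i * v₂ := by
    intro i
    have h := ((hb2.sub (hb.mul_left (2 * a i))).add (h₂.mul_left (a i ^ 2))).mul_left (w₁ i)
    rw [show w₁ i * a i ^ 2 + w₁ i * v₂ = w₁ i * (v₂ - 2 * a i * 0 + a i ^ 2 * 1) by ring,
      ← h.tsum_eq]
    refine tsum_congr fun j => ?_
    ring
  simp only [hin]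
  simpa using (ha2.add (h₁.mul_right v₂)).tsum_eq

theorem div_add_div_lt_variance_bound {r p : ℝ} (hr : 2 ≤ r) (hp0 : 0 < p) (hp1 : p < 1) :
    (1 - p) / (r - (1 - p)) + p / (r - p) <
      (r ^ 2 - r / 4 - 1 / 4) / ((r - 1 + p) * (r - p) * (r - 1 / 2)) -
        (p * (1 - p) / (r - 1 / 2) ^ 2) * (1 - 1 / (2 * r - 3)) := by
  have hA : 0 < r - 1 + p := by linarith
  have hB : 0 < r - p := by linarith
  have hm : 0 < r - 1 / 2 := by linarith
  have hs : 0 < p * (1 - p) := mul_pos hp0 (by linarith)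
  have hs4 : p * (1 - p) ≤ 1 / 4 := by nlinarith [sq_nonneg (p - 1 / 2)]
  have hAB : (r - 1 + p) * (r - p) = r * (r - 1) + p * (1 - p) := by ring
  have hlast : (p * (1 - p) / (r - 1 / 2) ^ 2) * (1 - 1 / (2 * r - 3)) ≤
      p * (1 - p) / (r - 1 / 2) ^ 2 := by
    refine mul_le_of_le_one_right (by positivity) ?_
    have : 0 ≤ 1 / (2 * r - 3) := one_div_nonneg.2 (by linarith)
    linarith
  have hmain : (r ^ 2 - r / 4 - 1 / 4) / ((r - 1 + p) * (r - p) * (r - 1 / 2)) -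
      ((1 - p) / (r - (1 - p)) + p / (r - p)) =
      (r / 4 - 1 / 4 + 2 * (p * (1 - p)) * (r - 1 / 2)) /
        ((r - 1 + p) * (r - p) * (r - 1 / 2)) := by
    rw [show r - (1 - p) = r - 1 + p by ring]
    rw [div_add_div _ _ hA.ne' hB.ne', div_sub_div _ _ (by positivity) (by positivity),
      div_eq_div_iff (by positivity) (by positivity)]
    ring
  have hlt : p * (1 - p) / (r - 1 / 2) ^ 2 <
      (r / 4 - 1 / 4 + 2 * (p * (1 - p)) * (r - 1 / 2)) /
        ((r - 1 + p) * (r - p) * (r - 1 / 2)) := by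
    rw [div_lt_div_iff₀ (by positivity) (by positivity), hAB]
    set s := p * (1 - p)
    have h1 : s * (r * (r - 1) + s) ≤ s * (r - 1 / 2) ^ 2 := by
      refine mul_le_mul_of_nonneg_left ?_ hs.le
      nlinarith
    have h2 : s * (r - 1 / 2) ^ 2 < (r / 4 - 1 / 4 + 2 * s * (r - 1 / 2)) * (r - 1 / 2) := by
      nlinarith [mul_pos hs (pow_pos hm 2)]
    nlinarith
  linarith

theorem log_odds_estimator_variance_bound (r : ℕ) (hr : 2 ≤ r) (p : ℝ)
    (hp0 : 0 < p) (hp1 : p < 1) :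
    negbinExp2 r p r (1 - p)
        (fun n₁ n₂ => (-H (n₁ - 1) + H (n₂ - 1) - Real.log (p / (1 - p))) ^ 2) <
      ((r : ℝ) ^ 2 - (r : ℝ) / 4 - 1 / 4) /
          (((r : ℝ) - 1 + p) * ((r : ℝ) - p) * ((r : ℝ) - 1 / 2)) -
        (p * (1 - p) / ((r : ℝ) - 1 / 2) ^ 2) * (1 - 1 / (2 * (r : ℝ) - 3)) := by
  obtain ⟨d, rfl⟩ : ∃ d, r = d + 2 := ⟨r - 2, by omega⟩
  have hq0 : 0 < 1 - p := by linarith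
  have hq1 : 1 - p < 1 := by linarith
  obtain ⟨v₁, hv₁, hs₁⟩ := exists_hasSum_negbinWeight_mul_centered_sq d hq0.le hq1
  obtain ⟨v₂, hv₂, hs₂⟩ := exists_hasSum_negbinWeight_mul_centered_sq d hp0.le hp1
  have hvar := tsum_tsum_mul_sub_sq
    (hasSum_negbinWeight d (by rwa [abs_of_pos hq0]))
    (hasSum_negbinWeight d (by rwa [abs_of_pos hp0]))
    (hasSum_negbinWeight_mul_centered d hp0.le hp1) hs₁ hs₂
  have heq : negbinExp2 (d + 2) p (d + 2) (1 - p)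
      (fun n₁ n₂ => (-H (n₁ - 1) + H (n₂ - 1) - Real.log (p / (1 - p))) ^ 2) = v₁ + v₂ := by
    rw [← hvar, negbinExp2]
    refine tsum_congr fun i => tsum_congr fun j => ?_
    rw [Real.log_div hp0.ne' hq0.ne', show d + 2 - 1 = d + 1 by omega,
      show d + 2 + i - 1 = i + (d + 1) by omega, show d + 2 + j - 1 = j + (d + 1) by omega,
      sub_sub_cancel]
    unfold negbinWeight
    rw [sub_sub_cancel]
    ring
  have hbound := div_add_div_lt_variance_bound (r := (d : ℝ) + 2)
    (by linarith [(Nat.cast_nonneg d : (0 : ℝ) ≤ d)]) hp0 hp1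
  rw [heq]
  push_cast
  linarith
end
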